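/- The function Γ is continuous on [0,∞)×ℝ; in particular, for every β ∈ ℝ and all sequences aₙ > 0 with aₙ → 0 and bₙ → β, one has Γ(aₙ, bₙ) → Γ(0, β) = l²·exp(−l²·max(β,0)/2). -/

import Mathlib

noncomputable def Phi (x : ℝ) : ℝ :=
  (Real.sqrt (2 * Real.pi))⁻¹ * ∫ y in Set.Iic x, Real.exp (-y ^ 2 / 2)

/-- The function `Γ` from the paper (depending on the parameter `l`). -/
noncomputable def Gam (l a b : ℝ) : ℝ :=
  if 0 < a then
    l ^ 2 * Phi (-(l * b) / (2 * Real.sqrt a))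
      + l ^ 2 * Real.exp (l ^ 2 * (a - b) / 2) * Phi (l * (b / (2 * Real.sqrt a) - Real.sqrt a))
  else l ^ 2 * Real.exp (-(l ^ 2 * max b 0) / 2)

/-- The function `𝒢` from the paper (depending on the parameter `l`). -/
noncomputable def Gcal (l a b : ℝ) : ℝ :=
  if 0 < a then
    l ^ 2 * Real.exp (l ^ 2 * (a - b) / 2) * Phi (l * (b / (2 * Real.sqrt a) - Real.sqrt a))
  else if 0 < b then l ^ 2 * Real.exp (-(l ^ 2 * b) / 2) else 0

open Filter Topology MeasureTheory

lemma integrable_exp_neg_sq_div_two : Integrable fun y : ℝ => Real.exp (-y ^ 2 / 2) := by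
  refine (integrable_exp_neg_mul_sq (b := 1 / 2) (by norm_num)).congr (ae_of_all _ fun y => ?_)
  simp only
  ring_nf

lemma integral_exp_neg_sq_div_two :
    ∫ y : ℝ, Real.exp (-y ^ 2 / 2) = Real.sqrt (2 * Real.pi) := by
  have h := integral_gaussian (1 / 2)
  rw [show Real.pi / (1 / 2) = 2 * Real.pi by ring] at h
  rw [← h]
  congr 1
  ext y
  ring_nf

lemma sqrt_two_pi_ne_zero : Real.sqrt (2 * Real.pi) ≠ 0 := by positivity

lemma Phi_add_Phi_neg (x : ℝ) : Phi x + Phi (-x) = 1 := by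
  have hneg : ∫ y in Set.Iic (-x), Real.exp (-y ^ 2 / 2)
      = ∫ y in Set.Ioi x, Real.exp (-y ^ 2 / 2) := by
    have h := integral_comp_neg_Iic (-x) fun y : ℝ => Real.exp (-y ^ 2 / 2)
    rw [neg_neg] at h
    rw [← h]
    congr 1
    ext y
    rw [neg_sq]
  have hsum := intervalIntegral.integral_Iic_add_Ioi (b := x)
    integrable_exp_neg_sq_div_two.integrableOn integrable_exp_neg_sq_div_two.integrableOn
  rw [Phi, Phi, hneg, ← mul_add, hsum, integral_exp_neg_sq_div_two,
    inv_mul_cancel₀ sqrt_two_pi_ne_zero]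

lemma Phi_neg (x : ℝ) : Phi (-x) = 1 - Phi x := by
  linarith [Phi_add_Phi_neg x]

lemma Phi_nonneg (x : ℝ) : 0 ≤ Phi x :=
  mul_nonneg (by positivity) (integral_nonneg fun _ => (Real.exp_pos _).le)

lemma Phi_le_one (x : ℝ) : Phi x ≤ 1 := by
  linarith [Phi_add_Phi_neg x, Phi_nonneg (-x)]

lemma tendsto_Phi_atTop : Tendsto Phi atTop (𝓝 1) := by
  have h := (aecover_Iic (μ := (volume : Measure ℝ)) tendsto_id
    ).integral_tendsto_of_countably_generated integrable_exp_neg_sq_div_two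
  rw [integral_exp_neg_sq_div_two] at h
  have h' := h.const_mul (Real.sqrt (2 * Real.pi))⁻¹
  rwa [inv_mul_cancel₀ sqrt_two_pi_ne_zero] at h'

lemma tendsto_Phi_atBot : Tendsto Phi atBot (𝓝 0) := by
  have h := (tendsto_Phi_atTop.comp tendsto_neg_atBot_atTop).const_sub 1
  simpa [Function.comp_def, Phi_neg] using h

lemma abs_Phi_sub_le (x y : ℝ) :
    |Phi y - Phi x| ≤ (Real.sqrt (2 * Real.pi))⁻¹ * |y - x| := by
  rw [Phi, Phi, ← mul_sub, intervalIntegral.integral_Iic_sub_Iic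
    integrable_exp_neg_sq_div_two.integrableOn integrable_exp_neg_sq_div_two.integrableOn,
    abs_mul, abs_of_nonneg (by positivity : 0 ≤ (Real.sqrt (2 * Real.pi))⁻¹)]
  refine mul_le_mul_of_nonneg_left ?_ (by positivity)
  have h := intervalIntegral.norm_integral_le_of_norm_le_const (a := x) (b := y) (C := 1)
    (f := fun t : ℝ => Real.exp (-t ^ 2 / 2)) fun t _ => by
      rw [Real.norm_eq_abs, Real.abs_exp, Real.exp_le_one_iff]
      linarith [sq_nonneg t]
  simpa using h

lemma continuous_Phi : Continuous Phi := by
  refine (LipschitzWith.of_dist_le_mul (K := (Real.sqrt (2 * Real.pi))⁻¹.toNNReal)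
    fun x y => ?_).continuous
  rw [Real.coe_toNNReal _ (by positivity)]
  exact abs_Phi_sub_le y x

/-- Convergence of the formula defining `Gam` on `0 < a` as `a` decreases to `0`. -/
lemma tendsto_Gam_formula {α : Type*} {F : Filter α} {a b : α → ℝ} {l β : ℝ} (hl : 0 < l)
    (ha : Tendsto a F (𝓝[>] 0)) (hb : Tendsto b F (𝓝 β)) :
    Tendsto (fun x => l ^ 2 * Phi (-(l * b x) / (2 * Real.sqrt (a x)))
      + l ^ 2 * Real.exp (l ^ 2 * (a x - b x) / 2)
        * Phi (l * (b x / (2 * Real.sqrt (a x)) - Real.sqrt (a x)))) F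
      (𝓝 (l ^ 2 * Real.exp (-(l ^ 2 * max β 0) / 2))) := by
  obtain ⟨ha0, hapos⟩ := tendsto_nhdsWithin_iff.1 ha
  have hsqrt : Tendsto (fun x => Real.sqrt (a x)) F (𝓝 0) := by
    simpa using ha0.sqrt
  have hinv : Tendsto (fun x => (2 * Real.sqrt (a x))⁻¹) F atTop := by
    refine tendsto_inv_nhdsGT_zero.comp (tendsto_nhdsWithin_iff.2 ⟨?_, ?_⟩)
    · simpa using hsqrt.const_mul 2
    · filter_upwards [hapos] with x hx
      exact mul_pos two_pos (Real.sqrt_pos.2 hx)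
  have hexp : Tendsto (fun x => Real.exp (l ^ 2 * (a x - b x) / 2)) F
      (𝓝 (Real.exp (-(l ^ 2 * β) / 2))) := by
    have h := (((ha0.sub hb).const_mul (l ^ 2)).div_const 2).rexp
    simpa using h
  rcases lt_trichotomy β 0 with hβ | rfl | hβ
  · have h₁ : Tendsto (fun x => -(l * b x) / (2 * Real.sqrt (a x))) F atTop := by
      simp only [div_eq_mul_inv]
      exact (hb.const_mul l).neg.pos_mul_atTop (by nlinarith) hinv
    have h₂ : Tendsto (fun x => l * (b x / (2 * Real.sqrt (a x)) - Real.sqrt (a x))) F atBot := by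
      simp only [div_eq_mul_inv, sub_eq_add_neg]
      exact ((hb.neg_mul_atTop hβ hinv).atBot_add hsqrt.neg).const_mul_atBot hl
    have h := ((tendsto_Phi_atTop.comp h₁).const_mul (l ^ 2)).add
      ((hexp.const_mul (l ^ 2)).mul (tendsto_Phi_atBot.comp h₂))
    simpa [Function.comp_def, max_eq_right hβ.le] using h
  · have hdiff : Tendsto (fun x => Phi (l * (b x / (2 * Real.sqrt (a x)) - Real.sqrt (a x)))
        - Phi (l * b x / (2 * Real.sqrt (a x)))) F (𝓝 0) := by
      refine squeeze_zero_norm (fun x => abs_Phi_sub_le _ _) ?_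
      have h := (hsqrt.const_mul l).neg.abs.const_mul (Real.sqrt (2 * Real.pi))⁻¹
      simp only [mul_zero, neg_zero, abs_zero] at h
      refine h.congr fun x => ?_
      ring_nf
    have hrem : Tendsto (fun x => (Real.exp (l ^ 2 * (a x - b x) / 2) - 1)
        * Phi (l * (b x / (2 * Real.sqrt (a x)) - Real.sqrt (a x)))) F (𝓝 0) := by
      refine squeeze_zero_norm (a := fun x => |Real.exp (l ^ 2 * (a x - b x) / 2) - 1|)
        (fun x => ?_) ?_
      · rw [Real.norm_eq_abs, abs_mul, abs_of_nonneg (Phi_nonneg _)]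
        exact mul_le_of_le_one_right (abs_nonneg _) (Phi_le_one _)
      · simpa using (hexp.sub_const 1).abs
    have h := ((hdiff.add hrem).const_add 1).const_mul (l ^ 2)
    simp only [max_self, mul_zero, neg_zero, zero_div, Real.exp_zero, add_zero] at h ⊢
    refine h.congr fun x => ?_
    rw [neg_div, Phi_neg]
    ring
  · have h₁ : Tendsto (fun x => -(l * b x) / (2 * Real.sqrt (a x))) F atBot := by
      simp only [div_eq_mul_inv]
      exact (hb.const_mul l).neg.neg_mul_atTop (by nlinarith) hinv
    have h₂ : Tendsto (fun x => l * (b x / (2 * Real.sqrt (a x)) - Real.sqrt (a x))) F atTop := by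
      simp only [div_eq_mul_inv, sub_eq_add_neg]
      exact ((hb.pos_mul_atTop hβ hinv).atTop_add hsqrt.neg).const_mul_atTop hl
    have h := ((tendsto_Phi_atBot.comp h₁).const_mul (l ^ 2)).add
      ((hexp.const_mul (l ^ 2)).mul (tendsto_Phi_atTop.comp h₂))
    simpa [Function.comp_def, max_eq_left hβ.le] using h

lemma continuousAt_Gam_of_pos (l : ℝ) {p : ℝ × ℝ} (hp : 0 < p.1) :
    ContinuousAt (fun p : ℝ × ℝ => Gam l p.1 p.2) p := by
  have hpos : ∀ᶠ q : ℝ × ℝ in 𝓝 p, 0 < q.1 := continuousAt_fst.eventually (lt_mem_nhds hp)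
  have hne : 2 * Real.sqrt p.1 ≠ 0 := by positivity
  have h₁ : ContinuousAt (fun q : ℝ × ℝ => Phi (-(l * q.2) / (2 * Real.sqrt q.1))) p :=
    continuous_Phi.continuousAt.comp (ContinuousAt.div (by fun_prop) (by fun_prop) hne)
  have hdiv : ContinuousAt (fun q : ℝ × ℝ => q.2 / (2 * Real.sqrt q.1)) p :=
    ContinuousAt.div (by fun_prop) (by fun_prop) hne
  have h₂ : ContinuousAt (fun q : ℝ × ℝ =>
      Phi (l * (q.2 / (2 * Real.sqrt q.1) - Real.sqrt q.1))) p :=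
    continuous_Phi.continuousAt.comp (by fun_prop)
  have h₃ : ContinuousAt (fun q : ℝ × ℝ => l ^ 2 * Real.exp (l ^ 2 * (q.1 - q.2) / 2)) p := by
    fun_prop
  refine ((h₁.const_mul (l ^ 2)).add (h₃.mul h₂)).congr ?_
  filter_upwards [hpos] with q hq
  simp only [Gam, if_pos hq, Pi.add_apply, Pi.mul_apply]

theorem stmt_6 (l : ℝ) (hl : 0 < l) :
    ContinuousOn (fun p : ℝ × ℝ => Gam l p.1 p.2) (Set.Ici 0 ×ˢ Set.univ) ∧
    ∀ (β : ℝ) (a b : ℕ → ℝ), (∀ n, 0 < a n) →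
      Filter.Tendsto a Filter.atTop (nhds 0) →
      Filter.Tendsto b Filter.atTop (nhds β) →
      Filter.Tendsto (fun n => Gam l (a n) (b n)) Filter.atTop
        (nhds (l ^ 2 * Real.exp (-(l ^ 2 * max β 0) / 2))) := by
  refine ⟨?_, fun β a b hapos ha hb => ?_⟩
  · rintro ⟨a, β⟩ ⟨ha : 0 ≤ a, -⟩
    rcases ha.eq_or_lt with rfl | ha
    · simp only [ContinuousWithinAt, Gam, lt_irrefl, if_false]
      refine Tendsto.if (tendsto_Gam_formula hl (tendsto_nhdsWithin_iff.2 ⟨?_, ?_⟩) ?_) ?_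
      · exact (continuous_fst.tendsto' _ _ rfl).mono_left (inf_le_left.trans nhdsWithin_le_nhds)
      · exact mem_inf_of_right (mem_principal_self _)
      · exact (continuous_snd.tendsto' _ _ rfl).mono_left (inf_le_left.trans nhdsWithin_le_nhds)
      · have h : Continuous fun p : ℝ × ℝ => l ^ 2 * Real.exp (-(l ^ 2 * max p.2 0) / 2) := by
          fun_prop
        exact (h.tendsto' _ _ rfl).mono_left (inf_le_left.trans nhdsWithin_le_nhds)
    · exact (continuousAt_Gam_of_pos l ha).continuousWithinAt
  · simp only [Gam, if_pos (hapos _)]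
    exact tendsto_Gam_formula hl
      (tendsto_nhdsWithin_iff.2 ⟨ha, Eventually.of_forall hapos⟩) hb
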